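/- arXiv:1405.4495 — 4 statements merged into one kernel-verified Lean document; each statement's English description precedes it below -/
import Mathlib

section
/- Let A be a unital C*-algebra, let m > 0 be real, and let P ∈ A be selfadjoint. Then m²·1 + P² is a positive invertible element; set S = √(m²·1 + P²), so m·1 + S is invertible, and set X = P·(m·1 + S)⁻¹. Then X is selfadjoint, X commutes with P, and X satisfies the Kutzelnigg quadratic equation 2m·X = P − X·P·X. -/
/-- In a unital C*-algebra, for `m > 0` real and `P` selfadjoint, `m²·1 + P²` is positive
and invertible; with `S = √(m²·1 + P²)`, `m·1 + S` is invertible, and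
`X = P·(m·1 + S)⁻¹` is selfadjoint, commutes with `P`, and satisfies the Kutzelnigg
quadratic equation `2m·X = P - X·P·X`. -/
theorem stmt13 {A : Type*} [CStarAlgebra A] [PartialOrder A] [StarOrderedRing A]
    (m : ℝ) (hm : 0 < m) (P : A) (hP : IsSelfAdjoint P) :
    0 ≤ m ^ 2 • (1 : A) + P ^ 2 ∧ IsUnit (m ^ 2 • (1 : A) + P ^ 2) ∧
    (let S : A := CFC.sqrt (m ^ 2 • (1 : A) + P ^ 2)
     IsUnit (m • (1 : A) + S) ∧
     (let X : A := P * Ring.inverse (m • (1 : A) + S)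
      IsSelfAdjoint X ∧ Commute X P ∧ (2 * m) • X = P - X * P * X)) := by
  have pos {c : ℝ} (hc : 0 < c) : IsStrictlyPositive (c • (1 : A)) :=
    isStrictlyPositive_one.smul hc
  have hQ : IsStrictlyPositive (m ^ 2 • (1 : A) + P ^ 2) :=
    (pos (by positivity)).add_nonneg hP.sq_nonneg
  refine ⟨hQ.nonneg, hQ.isUnit, ?_⟩
  intro S
  have hS : 0 ≤ S := CFC.sqrt_nonneg _
  have hSS : S * S = m ^ 2 • (1 : A) + P ^ 2 := CFC.sqrt_mul_sqrt_self _ hQ.nonneg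
  have hSP : Commute S P := by
    have h : Commute (m ^ 2 • (1 : A) + P ^ 2) P :=
      ((Commute.one_left P).smul_left _).add_left ((Commute.refl P).pow_left 2)
    exact h.cfcₙ_nnreal _
  have hT : IsStrictlyPositive (m • (1 : A) + S) := (pos hm).add_nonneg hS
  refine ⟨hT.isUnit, ?_⟩
  have hTT : (m • (1 : A) + S) * (m • (1 : A) + S) = (2 * m) • (m • (1 : A) + S) + P * P := by
    simp only [add_mul, mul_add, smul_mul_assoc, mul_smul_comm, one_mul, mul_one, hSS, sq]
    module
  have hTP : Commute (m • (1 : A) + S) P := ((Commute.one_left P).smul_left _).add_left hSP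
  generalize m • (1 : A) + S = T at *
  have hR : IsSelfAdjoint (Ring.inverse T) := hT.nonneg.isSelfAdjoint.ringInverse
  have hRT := Ring.inverse_mul_cancel T hT.isUnit
  have hTR := Ring.mul_inverse_cancel T hT.isUnit
  generalize Ring.inverse T = R at *
  have hRP : Commute R P := by
    calc R * P = R * (P * T) * R := by simp only [mul_assoc, hTR, mul_one]
      _ = P * R := by rw [← hTP.eq, ← mul_assoc, hRT, one_mul]
  refine ⟨(hP.commute_iff hR).1 hRP.symm, (Commute.refl P).mul_left hRP, ?_⟩
  have key : R * (P * P) * R = 1 - (2 * m) • R := by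
    rw [← sub_eq_iff_eq_add'.2 hTT, mul_sub, sub_mul, ← mul_assoc, hRT, one_mul, hTR,
      mul_smul_comm, hRT, smul_mul_assoc, one_mul]
  calc (2 * m) • (P * R) = P - P * (1 - (2 * m) • R) := by
        rw [mul_sub, mul_one, mul_smul_comm, sub_sub_cancel]
    _ = P - P * R * P * (P * R) := by rw [← key]; simp only [mul_assoc]
end

section
/- Let A be a unital C*-algebra, let m > 0 be real, and let Ω ∈ A be invertible. Set T = √(m²·1 + Ω·Ω*) − m·1. Then T is invertible, and the element X = Ω⁻¹·T satisfies the Kutzelnigg condition 2m·X = Ω* − X·Ω·X; moreover X*·X = T·(2m·1 + T)⁻¹ (so in particular X*·X commutes with T). -/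
/-- In a unital C*-algebra, for `m > 0` real and `Ω` invertible, the element
`T = √(m²·1 + Ω·Ω*) - m·1` is invertible, and `X = Ω⁻¹·T` satisfies the Kutzelnigg
condition `2m·X = Ω* - X·Ω·X`; moreover `X*·X = T·(2m·1 + T)⁻¹`, so in particular
`X*·X` commutes with `T`. -/
theorem stmt16 {A : Type*} [CStarAlgebra A] [PartialOrder A] [StarOrderedRing A]
    (m : ℝ) (hm : 0 < m) (Ω : A) (hΩ : IsUnit Ω) :
    let T : A := CFC.sqrt (m ^ 2 • (1 : A) + Ω * star Ω) - m • (1 : A)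
    let X : A := Ring.inverse Ω * T
    IsUnit T ∧ (2 * m) • X = star Ω - X * Ω * X ∧
    star X * X = T * Ring.inverse ((2 * m) • (1 : A) + T) ∧
    Commute (star X * X) T := by
  intro T X
  have hpos : (0 : A) ≤ m ^ 2 • (1 : A) + Ω * star Ω :=
    add_nonneg (smul_nonneg (by positivity) zero_le_one) (mul_star_self_nonneg Ω)
  have hsq := CFC.sqrt_mul_sqrt_self _ hpos
  have hSsa : IsSelfAdjoint (CFC.sqrt (m ^ 2 • (1 : A) + Ω * star Ω)) :=
    (CFC.sqrt_nonneg _).isSelfAdjoint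
  have hT : star T = T := by simp [T, hSsa.star_eq]
  have hTU : T * ((2 * m) • (1 : A) + T) = Ω * star Ω := by
    simp only [T, sub_mul, mul_sub, mul_add, hsq, smul_mul_assoc, mul_smul_comm, one_mul, mul_one]
    module
  have hcomm : Commute T ((2 * m) • (1 : A) + T) :=
    ((Commute.one_right T).smul_right _).add_right (Commute.refl T)
  obtain ⟨hTunit, hUunit⟩ := hcomm.isUnit_mul_iff.mp (hTU ▸ hΩ.mul hΩ.star)
  have hΩX : Ω * X = T := Ring.mul_inverse_cancel_left _ _ hΩ
  have hXU : X * ((2 * m) • (1 : A) + T) = star Ω := by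
    rw [mul_assoc, hTU, Ring.inverse_mul_cancel_left _ _ hΩ]
  have hXX : star X * X = T * Ring.inverse ((2 * m) • (1 : A) + T) := by
    rw [Ring.eq_mul_inverse_iff_mul_eq _ _ _ hUunit, mul_assoc, hXU, ← star_mul, hΩX, hT]
  refine ⟨hTunit, ?_, hXX, ?_⟩
  · rw [mul_assoc, hΩX, eq_sub_iff_add_eq, ← hXU, mul_add, mul_smul_comm, mul_one]
  · rw [hXX, Ring.inverse_of_isUnit hUunit]
    exact (Commute.refl T).mul_left (Commute.units_inv_left hcomm.symm)
end

section
/- Let A be a unital C*-algebra and X ∈ A. The elements 1 + X*·X and 1 + X·X* are positive and invertible; set Y = (√(1 + X*·X))⁻¹ and Z = (√(1 + X·X*))⁻¹. Then the 2×2 matrix U over A given by U = [[Y, Y·X*], [−Z·X, Z]] is unitary: U·Uᴴ = 1 and Uᴴ·U = 1, where Uᴴ denotes the conjugate transpose (transpose with entrywise star) and 1 is the identity of the 2×2 matrices over A. -/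
/-- The element `1 + x⋆ x` of a unital C⋆-algebra is strictly positive. -/
theorem isStrictlyPositive_one_add_star_mul_self {A : Type*} [CStarAlgebra A] [PartialOrder A]
    [StarOrderedRing A] (x : A) : IsStrictlyPositive ((1 : A) + star x * x) :=
  IsStrictlyPositive.add_nonneg isStrictlyPositive_one (star_mul_self_nonneg x)

/-- The inverse square root `y` of a strictly positive `a` is selfadjoint, satisfies `y a y = 1`,
and `y * y` is a two-sided inverse of `a`. -/
theorem inverse_sqrt_spec {A : Type*} [CStarAlgebra A] [PartialOrder A] [StarOrderedRing A]
    {a : A} (ha : IsStrictlyPositive a) :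
    star (Ring.inverse (CFC.sqrt a)) = Ring.inverse (CFC.sqrt a) ∧
    Ring.inverse (CFC.sqrt a) * a * Ring.inverse (CFC.sqrt a) = 1 ∧
    a * (Ring.inverse (CFC.sqrt a) * Ring.inverse (CFC.sqrt a)) = 1 ∧
    Ring.inverse (CFC.sqrt a) * Ring.inverse (CFC.sqrt a) * a = 1 := by
  have hs : CFC.sqrt a * CFC.sqrt a = a := CFC.sqrt_mul_sqrt_self a ha.nonneg
  have hu : IsUnit (CFC.sqrt a) := (CFC.isUnit_sqrt_iff a ha.nonneg).2 ha.isUnit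
  have hstar : star (CFC.sqrt a) = CFC.sqrt a := (CFC.sqrt_nonneg a).isSelfAdjoint
  have hr := Ring.mul_inverse_cancel _ hu
  have hl := Ring.inverse_mul_cancel _ hu
  generalize CFC.sqrt a = s at *
  subst hs
  refine ⟨by rw [← Ring.inverse_star, hstar], ?_, ?_, ?_⟩
  · rw [← mul_assoc, hl, one_mul, hr]
  · rw [mul_assoc, ← mul_assoc s (Ring.inverse s), hr, one_mul, hr]
  · rw [mul_assoc, ← mul_assoc (Ring.inverse s) s, hl, one_mul, hl]

/-- In a unital C*-algebra, for any `X`, the elements `1 + X*·X` and `1 + X·X*` are positive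
and invertible; with `Y = (√(1 + X*·X))⁻¹` and `Z = (√(1 + X·X*))⁻¹`, the 2×2 matrix
`U = [[Y, Y·X*], [-Z·X, Z]]` is unitary: `U·Uᴴ = 1` and `Uᴴ·U = 1`. -/
theorem stmt17 {A : Type*} [CStarAlgebra A] [PartialOrder A] [StarOrderedRing A] (X : A) :
    0 ≤ (1 : A) + star X * X ∧ IsUnit ((1 : A) + star X * X) ∧
    0 ≤ (1 : A) + X * star X ∧ IsUnit ((1 : A) + X * star X) ∧
    (let Y : A := Ring.inverse (CFC.sqrt ((1 : A) + star X * X))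
     let Z : A := Ring.inverse (CFC.sqrt ((1 : A) + X * star X))
     let U : Matrix (Fin 2) (Fin 2) A := !![Y, Y * star X; -(Z * X), Z]
     U * U.conjTranspose = 1 ∧ U.conjTranspose * U = 1) := by
  have hP := isStrictlyPositive_one_add_star_mul_self X
  have hQ : IsStrictlyPositive ((1 : A) + X * star X) := by
    simpa using isStrictlyPositive_one_add_star_mul_self (star X)
  refine ⟨hP.nonneg, hP.isUnit, hQ.nonneg, hQ.isUnit, ?_⟩
  intro Y Z U
  obtain ⟨hY, hYPY, -, hYP⟩ : star Y = Y ∧ Y * (1 + star X * X) * Y = 1 ∧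
      (1 + star X * X) * (Y * Y) = 1 ∧ Y * Y * (1 + star X * X) = 1 := inverse_sqrt_spec hP
  obtain ⟨hZ, hZQZ, hQZ, hZQ⟩ : star Z = Z ∧ Z * (1 + X * star X) * Z = 1 ∧
      (1 + X * star X) * (Z * Z) = 1 ∧ Z * Z * (1 + X * star X) = 1 := inverse_sqrt_spec hQ
  have hU : U.conjTranspose = !![Y, -(star X * Z); X * Y, Z] := by
    ext i j
    fin_cases i <;> fin_cases j <;> simp [U, hY, hZ]
  have hXZ : Y * Y * star X = star X * (Z * Z) := by
    calc Y * Y * star X = Y * Y * star X * ((1 + X * star X) * (Z * Z)) := by rw [hQZ, mul_one]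
      _ = Y * Y * (1 + star X * X) * (star X * (Z * Z)) := by noncomm_ring
      _ = star X * (Z * Z) := by rw [hYP, one_mul]
  have hXY : X * (Y * Y) = Z * Z * X := by
    simpa [hY, hZ, mul_assoc] using congrArg star hXZ
  rw [hU, Matrix.one_fin_two]
  simp only [U, Matrix.mul_fin_two]
  have h₁ : Y * Y + Y * star X * (X * Y) = 1 := by
    rw [← hYPY]; noncomm_ring
  have h₂ : Z * X * (star X * Z) + Z * Z = 1 := by
    rw [← hZQZ]; noncomm_ring
  have h₃ : Y * Y + star X * Z * (Z * X) = 1 := by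
    calc Y * Y + star X * Z * (Z * X) = Y * Y + star X * (Z * Z) * X := by noncomm_ring
      _ = Y * Y * (1 + star X * X) := by rw [← hXZ]; noncomm_ring
      _ = 1 := hYP
  have h₄ : X * Y * (Y * star X) + Z * Z = 1 := by
    calc X * Y * (Y * star X) + Z * Z = X * (Y * Y) * star X + Z * Z := by noncomm_ring
      _ = Z * Z * (1 + X * star X) := by rw [hXY]; noncomm_ring
      _ = 1 := hZQ
  have h₅ : Y * (Y * star X) = star X * Z * Z := by rw [← mul_assoc, hXZ, mul_assoc]
  have h₆ : X * Y * Y = Z * (Z * X) := by rw [mul_assoc, hXY, mul_assoc]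
  constructor
  · have h₇ : Y * star X * Z = Y * (star X * Z) := mul_assoc _ _ _
    have h₈ : Z * X * Y = Z * (X * Y) := mul_assoc _ _ _
    simp only [neg_mul, mul_neg, neg_neg, h₁, h₂, h₇, h₈, neg_add_cancel]
  · simp only [neg_mul, mul_neg, neg_neg, h₃, h₄, h₅, h₆, add_neg_cancel]
end

section
/- Let A be a unital C*-algebra and let H₊, H₋, H₀, X ∈ A with H₊* = H₊, H₋* = H₋, and suppose X satisfies the block-diagonalization condition H₀* − X·H₊ + H₋·X − X·H₀·X = 0. Set Y = (√(1 + X*·X))⁻¹, Z = (√(1 + X·X*))⁻¹, U = [[Y, Y·X*], [−Z·X, Z]] and H = [[H₊, H₀], [H₀*, H₋]] as 2×2 matrices over A. Then the transformed Hamiltonian U·H·Uᴴ is block diagonal: its (1,2) entry and its (2,1) entry are both 0. -/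
/-- In a unital C*-algebra, let `H₊, H₋` be selfadjoint, `H₀` arbitrary, and suppose `X`
satisfies the block-diagonalization condition `H₀* - X·H₊ + H₋·X - X·H₀·X = 0`. With
`Y = (√(1 + X*·X))⁻¹`, `Z = (√(1 + X·X*))⁻¹`, `U = [[Y, Y·X*], [-Z·X, Z]]`, and
`H = [[H₊, H₀], [H₀*, H₋]]`, the transformed Hamiltonian `U·H·Uᴴ` is block diagonal:
its (1,2) and (2,1) entries vanish. -/
theorem stmt18 {A : Type*} [CStarAlgebra A] [PartialOrder A] [StarOrderedRing A]
    (Hp Hm H0 X : A) (hHp : IsSelfAdjoint Hp) (hHm : IsSelfAdjoint Hm)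
    (hX : star H0 - X * Hp + Hm * X - X * H0 * X = 0) :
    let Y : A := Ring.inverse (CFC.sqrt ((1 : A) + star X * X))
    let Z : A := Ring.inverse (CFC.sqrt ((1 : A) + X * star X))
    let U : Matrix (Fin 2) (Fin 2) A := !![Y, Y * star X; -(Z * X), Z]
    let H : Matrix (Fin 2) (Fin 2) A := !![Hp, H0; star H0, Hm]
    (U * H * U.conjTranspose) 0 1 = 0 ∧ (U * H * U.conjTranspose) 1 0 = 0 := by
  intro Y Z U H
  have hX' : H0 - Hp * star X + star X * Hm - star X * star H0 * star X = 0 := by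
    simpa [hHp.star_eq, hHm.star_eq, mul_assoc] using congrArg star hX
  constructor
  · calc (U * H * U.conjTranspose) 0 1
        = Y * (H0 - Hp * star X + star X * Hm - star X * star H0 * star X) * star Z := by
          simp [U, H, Matrix.mul_apply, Fin.sum_univ_two]
          noncomm_ring
      _ = 0 := by simp [hX']
  · calc (U * H * U.conjTranspose) 1 0
        = Z * (star H0 - X * Hp + Hm * X - X * H0 * X) * star Y := by
          simp [U, H, Matrix.mul_apply, Fin.sum_univ_two]
          noncomm_ring
      _ = 0 := by simp [hX]
end
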